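/- The property of N-almost divisibility passes to quotients: if A is N-almost divisible and I is a closed two-sided ideal of A, then A/I is N-almost divisible. -/

import Mathlib

open Filter Topology
open scoped ENNReal

/-! Basic Cuntz semigroup machinery over matrix amplifications of a unital C*-algebra `A`.
Classes in `Cu(A)` are represented by positive elements of `Mₙ(A)` for varying `n`. -/

/-- Square matrices over `A`. -/
abbrev Mat (A : Type*) (n : ℕ) := Matrix (Fin n) (Fin n) A

variable {A : Type*} [CStarAlgebra A]

/-- Positivity in a matrix algebra over a C*-algebra: `x = z*z` for some `z`. -/
def MatPos {n : ℕ} (x : Mat A n) : Prop := ∃ z : Mat A n, x = star z * z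

/-- Embedding of `Mₙ(A)` as an upper-left corner of `M_N(A)`. -/
def toBig {n N : ℕ} (_h : n ≤ N) (x : Mat A n) : Mat A N :=
  Matrix.of fun i j =>
    if hi : (i : ℕ) < n then if hj : (j : ℕ) < n then x ⟨i, hi⟩ ⟨j, hj⟩ else 0 else 0

/-- Cuntz subequivalence of matrix classes: `x ≾ y` iff, after embedding both in a common
matrix algebra, there is a sequence `dₖ` with `dₖ* y dₖ → x`. -/
def CuLE {n m : ℕ} (x : Mat A n) (y : Mat A m) : Prop :=
  ∃ d : ℕ → Mat A (max n m),
    Tendsto (fun k => star (d k) * toBig (le_max_right n m) y * d k) atTop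
      (𝓝 (toBig (le_max_left n m) x))

/-- Direct sum of matrix classes (block diagonal). -/
def mdsum {n m : ℕ} (x : Mat A n) (y : Mat A m) : Mat A (n + m) :=
  (Matrix.reindex finSumFinEquiv finSumFinEquiv) (Matrix.fromBlocks x 0 0 y)

/-- Block diagonal sum of a finite family of matrix classes of the same size. -/
def bdiag {m k : ℕ} (b : Fin k → Mat A m) : Mat A (m * k) :=
  (Matrix.reindex finProdFinEquiv finProdFinEquiv) (Matrix.blockDiagonal b)

/-- The `k`-fold amplification `k·[x]` of a matrix class. -/
def ampm (k : ℕ) {m : ℕ} (x : Mat A m) : Mat A (m * k) := bdiag fun _ : Fin k => x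

/-- Continuous functional calculus on positive contractions in `Mₙ(A)`, defined canonically
via limits of Bernstein polynomials.  (For a positive contraction `x` and continuous `f`,
this is the usual `f(x)`; the value is junk otherwise.) -/
noncomputable def mcfc (f : ℝ → ℝ) {n : ℕ} (x : Mat A n) : Mat A n :=
  limUnder atTop fun k : ℕ =>
    ∑ j ∈ Finset.range (k + 1),
      (f ((j : ℝ) / (k : ℝ)) * (k.choose j : ℝ)) • (x ^ j * (1 - x) ^ (k - j))

/-- An explicit upper bound for the norm of a matrix over `A`. -/
noncomputable def scaleOf {n : ℕ} (x : Mat A n) : ℝ := (∑ i, ∑ j, ‖x i j‖) + 1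

/-- The positive cut-down `(x - ε)₊` of a positive matrix, via functional calculus. -/
noncomputable def posPartM (ε : ℝ) {n : ℕ} (x : Mat A n) : Mat A n :=
  scaleOf x • mcfc (fun t => max (t - ε / scaleOf x) 0) ((scaleOf x)⁻¹ • x)

/-- The root `x^{1/m}` of a positive matrix, via functional calculus. -/
noncomputable def rootM (m : ℕ) {n : ℕ} (x : Mat A n) : Mat A n :=
  (scaleOf x ^ ((m : ℝ)⁻¹)) • mcfc (fun t => t ^ ((m : ℝ)⁻¹)) ((scaleOf x)⁻¹ • x)

/-- A 2-quasitrace on `A`, extended (canonically) to all matrix amplifications of `A`: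
it vanishes at 0, is tracial, additive on commuting positive elements, positively
homogeneous, order preserving, and compatible with the corner embeddings. -/
structure MQT (A : Type*) [CStarAlgebra A] where
  toFun : ∀ n, Mat A n → ℝ≥0∞
  map_zero' : ∀ n, toFun n 0 = 0
  tracial' : ∀ (n) (x : Mat A n), toFun n (star x * x) = toFun n (x * star x)
  add_commute' : ∀ (n) (x y : Mat A n), MatPos x → MatPos y → x * y = y * x →
    toFun n (x + y) = toFun n x + toFun n y
  smul' : ∀ (n) (r : ℝ) (x : Mat A n), 0 ≤ r → MatPos x →
    toFun n (r • x) = ENNReal.ofReal r * toFun n x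
  mono' : ∀ (n) (x y : Mat A n), MatPos x → MatPos (y - x) → toFun n x ≤ toFun n y
  compat' : ∀ (n N) (h : n ≤ N) (x : Mat A n), toFun N (toBig h x) = toFun n x

/-- The dimension function `d_τ(x) = lim_m τ(x^{1/m}) = sup_m τ(x^{1/m})`. -/
noncomputable def dM (τ : MQT A) {n : ℕ} (x : Mat A n) : ℝ≥0∞ :=
  ⨆ m : ℕ, τ.toFun n (rootM (m + 1) x)

/-- A quasitrace is bounded if it is finite on the unit of `A`. -/
def MQT.IsBounded (τ : MQT A) : Prop := τ.toFun 1 1 < ⊤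

/-- `[x] <_s γ·[y]`: `d_τ(x) ≤ γ'·d_τ(y)` for some `γ' < γ` and all quasitraces `τ`. -/
def StrictCuCompare (γ : ℝ) {r s : ℕ} (x : Mat A r) (y : Mat A s) : Prop :=
  ∃ γ' : ℝ, 0 ≤ γ' ∧ γ' < γ ∧ ∀ τ : MQT A, dM τ x ≤ ENNReal.ofReal γ' * dM τ y

/-- `A` has `M`-comparison: `[a] <_s [bᵢ]` for `i = 0, …, M` implies `[a] ≤ Σᵢ [bᵢ]`. -/
def MComparison (A : Type*) [CStarAlgebra A] (M : ℕ) : Prop :=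
  ∀ (r s : ℕ) (a : Mat A r) (b : Fin (M + 1) → Mat A s),
    MatPos a → (∀ i, MatPos (b i)) →
    (∀ i, StrictCuCompare 1 a (b i)) → CuLE a (bdiag b)

/-- A positive matrix class `[c]` is pseudocompact if `[c] ≤ k[(c-ε)₊]` for some `ε > 0`. -/
def Pseudocompact {n : ℕ} (c : Mat A n) : Prop :=
  ∃ ε : ℝ, 0 < ε ∧ ∃ k : ℕ, CuLE c (ampm k (posPartM ε c))

/-- A class `[c]` is stably properly infinite if `c ≠ 0` and `(k+1)[c] ≤ k[c]` for some `k`. -/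
def StablyProperlyInfinite {n : ℕ} (c : Mat A n) : Prop :=
  c ≠ 0 ∧ ∃ k : ℕ, 0 < k ∧ CuLE (ampm (k + 1) c) (ampm k c)

/-- `A` is `N`-almost divisible: for each `[a] ∈ Cu(A)`, `k ∈ ℕ` and `ε > 0` there is `[b]`
with `k[b] ≤ [a]` and `[(a-ε)₊] ≤ (k+1)(N+1)[b]`. -/
def AlmostDivisible (A : Type*) [CStarAlgebra A] (N : ℕ) : Prop :=
  ∀ (r : ℕ) (a : Mat A r), MatPos a → ∀ k : ℕ, 0 < k → ∀ ε : ℝ, 0 < ε →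
    ∃ (s : ℕ) (b : Mat A s), MatPos b ∧ CuLE (ampm k b) a ∧
      CuLE (posPartM ε a) (ampm ((k + 1) * (N + 1)) b)

theorem aux_bern {D : Type*} [CStarAlgebra D] (x : D) (hx : IsSelfAdjoint x)
    (hs : spectrum ℝ x ⊆ Set.Icc 0 1) (f : ℝ → ℝ) (hf : Continuous f) :
    Tendsto (fun k : ℕ => ∑ j ∈ Finset.range (k + 1),
      (f ((j : ℝ) / (k : ℝ)) * (k.choose j : ℝ)) • (x ^ j * (1 - x) ^ (k - j))) atTop
      (𝓝 (cfc f x)) := by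
  have key : ∀ k : ℕ, (∑ j ∈ Finset.range (k + 1),
      (f ((j : ℝ) / (k : ℝ)) * (k.choose j : ℝ)) • (x ^ j * (1 - x) ^ (k - j))) =
      cfc (fun t : ℝ => ∑ j ∈ Finset.range (k + 1),
        (f ((j : ℝ) / (k : ℝ)) * (k.choose j : ℝ)) • (t ^ j * (1 - t) ^ (k - j))) x := by
    intro k
    rw [← Finset.sum_fn, cfc_sum _ _ _ (fun i _ => by fun_prop)]
    refine Finset.sum_congr rfl fun j _ => ?_
    rw [cfc_smul _ _ _ (by fun_prop), cfc_mul _ _ _ (by fun_prop) (by fun_prop),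
      cfc_pow_id x j, cfc_pow _ _ _ (by fun_prop), cfc_sub _ _ _ (by fun_prop) (by fun_prop),
      cfc_const_one ℝ x, cfc_id' ℝ x]
  simp_rw [key]
  refine tendsto_cfc_fun ?_ (.of_forall fun k => by fun_prop)
  have hb := bernsteinApproximation_uniform
    (⟨fun t : unitInterval => f t, by fun_prop⟩ : C(unitInterval, ℝ))
  rw [ContinuousMap.tendsto_iff_tendstoUniformly, Metric.tendstoUniformly_iff] at hb
  rw [Metric.tendstoUniformlyOn_iff]
  intro ε hε
  filter_upwards [hb ε hε] with k hk t ht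
  have := hk ⟨t, hs ht⟩
  have e : (∑ j ∈ Finset.range (k + 1),
        (f ((j : ℝ) / (k : ℝ)) * (k.choose j : ℝ)) • (t ^ j * (1 - t) ^ (k - j))) =
      bernsteinApproximation k
        (⟨fun t : unitInterval => f t, by fun_prop⟩ : C(unitInterval, ℝ)) ⟨t, hs ht⟩ := by
    simp only [bernsteinApproximation, Finset.sum_range, ContinuousMap.sum_apply]
    refine Finset.sum_congr rfl fun j _ => ?_
    simp [bernstein_apply, bernstein.z]
    ring
  rw [e]
  exact this

theorem aux_norm {A : Type*} [CStarAlgebra A] [PartialOrder A] [StarOrderedRing A] {n : ℕ}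
    (M : CStarMatrix (Fin n) (Fin n) A) : ‖M‖ ≤ ∑ i, ∑ j, ‖M i j‖ := by
  rw [CStarMatrix.norm_def, Finset.sum_comm]
  refine (CStarMatrix.toCLM M).opNorm_le_bound (by positivity) fun v => ?_
  simp only [CStarMatrix.toCLM_apply_eq_sum, Finset.sum_mul]
  apply WithCStarModule.pi_norm_le_sum_norm _ |>.trans
  gcongr with i _
  change ‖∑ k, v k * M k i‖ ≤ _
  apply norm_sum_le _ _ |>.trans
  gcongr with j _
  apply norm_mul_le _ _ |>.trans
  rw [mul_comm]
  gcongr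
  exact WithCStarModule.norm_apply_le_norm v j

theorem aux_scale {D : Type*} [CStarAlgebra D] (x : D) (hx : IsSelfAdjoint x)
    (h0 : ∀ t ∈ spectrum ℝ x, 0 ≤ t) (s : ℝ) (hs : 0 < s) (hxs : ‖x‖ ≤ s) (ε : ℝ) :
    s • limUnder atTop (fun k : ℕ => ∑ j ∈ Finset.range (k + 1),
      (max ((j : ℝ) / (k : ℝ) - ε / s) 0 * (k.choose j : ℝ)) •
        ((s⁻¹ • x) ^ j * (1 - s⁻¹ • x) ^ (k - j)))
      = cfc (fun t : ℝ => max (t - ε) 0) x := by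
  have hsx : IsSelfAdjoint (s⁻¹ • x) := (IsSelfAdjoint.all s⁻¹).smul hx
  have hspec : spectrum ℝ (s⁻¹ • x) ⊆ Set.Icc 0 1 := by
    intro t ht
    rw [← cfc_const_mul_id s⁻¹ x, cfc_map_spectrum (fun t : ℝ => s⁻¹ * t) x] at ht
    obtain ⟨u, hu, rfl⟩ := ht
    have h1 := h0 u hu
    have h2 : u ≤ s := by
      have : Nontrivial D := by
        by_contra hD
        rw [not_nontrivial_iff_subsingleton] at hD
        simp [spectrum.of_subsingleton] at hu
      have := spectrum.norm_le_norm_of_mem hu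
      exact (le_abs_self u).trans (this.trans hxs)
    refine ⟨by positivity, ?_⟩
    change s⁻¹ * u ≤ 1
    rw [inv_mul_le_iff₀ hs]; simpa using h2
  have := aux_bern (s⁻¹ • x) hsx hspec (fun t => max (t - ε / s) 0) (by fun_prop)
  rw [this.limUnder_eq, ← cfc_comp_const_mul _ _ _ (by fun_prop), ← cfc_const_mul _ _ _ (by fun_prop)]
  congr 1
  ext t
  rw [mul_max_of_nonneg _ _ hs.le]
  congr 1
  · field_simp
  · simp

noncomputable def auxCut {D : Type*} [CStarAlgebra D] (ε : ℝ) (x : D) : D :=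
  cfc (p := IsSelfAdjoint) (fun t : ℝ => max (t - ε) 0) x

open scoped CStarAlgebra in
theorem aux_map_cut {D E : Type*} [CStarAlgebra D] [CStarAlgebra E] (φ : D →⋆ₐ[ℂ] E) (ε : ℝ)
    (z : D) : φ (auxCut ε (star z * z)) = auxCut ε (star (φ z) * φ z) := by
  have h := StarAlgHom.map_cfc (R := ℝ) (S := ℂ) φ (fun t : ℝ => max (t - ε) 0)
    (star z * z) (by fun_prop) (map_continuous φ) (.star_mul_self _)
    ((IsSelfAdjoint.star_mul_self _).map _)
  rw [map_mul, map_star] at h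
  exact h

theorem aux_posPart {A : Type*} [CStarAlgebra A] [PartialOrder A] [StarOrderedRing A] {n : ℕ}
    (z : Mat A n) (ε : ℝ) :
    posPartM ε (star z * z) =
      auxCut (D := CStarMatrix (Fin n) (Fin n) A) ε (star z * z) := by
  have hn : norm (E := CStarMatrix (Fin n) (Fin n) A) (star z * z) ≤ scaleOf (star z * z) := by
    refine (aux_norm (A := A) (n := n) (star z * z)).trans ?_
    exact le_add_of_nonneg_right zero_le_one
  have hp : 0 < scaleOf (star z * z) := by
    unfold scaleOf; positivity
  exact aux_scale (D := CStarMatrix (Fin n) (Fin n) A) (star z * z)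
    (IsSelfAdjoint.star_mul_self (R := CStarMatrix (Fin n) (Fin n) A) z)
    (spectrum_star_mul_self_nonneg (A := CStarMatrix (Fin n) (Fin n) A) (b := z)) _ hp hn ε

noncomputable def auxHom {A B : Type*} [CStarAlgebra A] [CStarAlgebra B] (π : A →⋆ₐ[ℂ] B) (n : ℕ) :
    CStarMatrix (Fin n) (Fin n) A →⋆ₐ[ℂ] CStarMatrix (Fin n) (Fin n) B where
  toFun M := Matrix.map M π
  map_one' := Matrix.map_one π (map_zero π) (map_one π)
  map_mul' _ _ := Matrix.map_mul
  map_zero' := Matrix.map_zero π (map_zero π)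
  map_add' := Matrix.map_add π (map_add π)
  commutes' r := by
    ext i j
    change π (algebraMap ℂ (CStarMatrix (Fin n) (Fin n) A) r i j) = _
    rw [CStarMatrix.algebraMap_apply, CStarMatrix.algebraMap_apply]
    split_ifs
    · exact AlgHomClass.commutes π r
    · exact map_zero π
  map_star' M := by
    ext i j
    exact map_star π (M j i)

theorem aux_map_posPart {A B : Type*} [CStarAlgebra A] [CStarAlgebra B] (π : A →⋆ₐ[ℂ] B)
    {n : ℕ} (z : Mat A n) (ε : ℝ) :
    (posPartM ε (star z * z)).map π = posPartM ε (star (z.map π) * z.map π) := by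
  let _ : PartialOrder A := CStarAlgebra.spectralOrder A
  let _ : StarOrderedRing A := CStarAlgebra.spectralOrderedRing A
  let _ : PartialOrder B := CStarAlgebra.spectralOrder B
  let _ : StarOrderedRing B := CStarAlgebra.spectralOrderedRing B
  rw [aux_posPart z ε, aux_posPart (z.map π) ε]
  exact aux_map_cut (D := CStarMatrix (Fin n) (Fin n) A) (E := CStarMatrix (Fin n) (Fin n) B)
    (auxHom π n) ε z

theorem aux_toBig {A B : Type*} [CStarAlgebra A] [CStarAlgebra B] (π : A →⋆ₐ[ℂ] B)
    {n m : ℕ} (h : n ≤ m) (x : Mat A n) : (toBig h x).map π = toBig h (x.map π) := by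
  ext i j
  simp only [toBig, Matrix.map_apply, Matrix.of_apply]
  split_ifs <;> simp

theorem aux_star {A B : Type*} [CStarAlgebra A] [CStarAlgebra B] (π : A →⋆ₐ[ℂ] B)
    {n : ℕ} (x : Mat A n) : (star x).map π = star (x.map π) := by
  ext i j
  exact map_star π (x j i)

theorem aux_CuLE {A B : Type*} [CStarAlgebra A] [CStarAlgebra B] (π : A →⋆ₐ[ℂ] B)
    (hc : Continuous π) {n m : ℕ} {x : Mat A n} {y : Mat A m} (h : CuLE x y) :
    CuLE (x.map π) (y.map π) := by
  obtain ⟨d, hd⟩ := h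
  refine ⟨fun k => (d k).map π, ?_⟩
  have hcont : Continuous (fun M : Mat A (max n m) => M.map π) := continuous_id.matrix_map hc
  have := (hcont.tendsto _).comp hd
  simp only [aux_toBig, Function.comp_def, Matrix.map_mul, aux_star] at this
  exact this

theorem aux_ampm {A B : Type*} [CStarAlgebra A] [CStarAlgebra B] (π : A →⋆ₐ[ℂ] B)
    (k : ℕ) {m : ℕ} (x : Mat A m) : (ampm k x).map π = ampm k (x.map π) := by
  ext i j
  simp only [ampm, bdiag, Matrix.reindex_apply, Matrix.submatrix_apply, Matrix.map_apply,
    Matrix.blockDiagonal_apply]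
  split_ifs <;> simp

/-- `N`-almost divisibility passes to quotients: if `A` is `N`-almost divisible and `B` is a
quotient of `A` by a closed two-sided ideal (equivalently, the image of a surjective
*-homomorphism), then `B` is `N`-almost divisible. -/
theorem stmt13 {A B : Type*} [CStarAlgebra A] [CStarAlgebra B] (N : ℕ)
    (π : A →⋆ₐ[ℂ] B) (hπ : Function.Surjective π)
    (hA : AlmostDivisible A N) :
    AlmostDivisible B N := by
  have hc : Continuous π := by
    open scoped CStarAlgebra in exact map_continuous π
  intro r a ha k hk ε hε
  obtain ⟨z, rfl⟩ := ha
  obtain ⟨w, rfl⟩ : ∃ w : Mat A r, w.map π = z := by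
    choose g hg using hπ
    exact ⟨z.map g, by ext i j; simp [hg]⟩
  obtain ⟨s, b, ⟨c, rfl⟩, h1, h2⟩ := hA r (star w * w) ⟨w, rfl⟩ k hk ε hε
  refine ⟨s, (star c * c).map π, ⟨c.map π, by rw [Matrix.map_mul, aux_star]⟩, ?_, ?_⟩
  · have := aux_CuLE π hc h1
    rwa [aux_ampm, Matrix.map_mul (M := w), aux_star π w] at this
  · have := aux_CuLE π hc h2
    rwa [aux_ampm, aux_map_posPart π] at this
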